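/- For positive integers t, n and a partition λ = (λ₁ ≥ ... ≥ λₙ ≥ 0), the number of bounded lecture hall tableaux of shape λ bounded by t equals t^{|λ|} · ∏_{1≤i<j≤n} (λᵢ - i - λⱼ + j)/(j - i), where |λ| = λ₁ + ... + λₙ. Equivalently, this count equals t^{|λ|} times the number of standard-type product ∏_{i<j}(aᵢ - aⱼ)/(j-i) with aᵢ = λᵢ + n - i. -/

import Mathlib

/-- A bounded lecture hall tableau of shape `lam` (a partition with `n` parts,
indexed from 0) bounded by `t`: a filling `T` of the Young diagram with
nonnegative integers such that (with 1-indexed paper coordinates `(i,j)`):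
`T(i,j) < t(n-i+j)`, `T(i,j)/(n-i+j) ≥ T(i,j+1)/(n-i+j+1)` and
`T(i,j)/(n-i+j) > T(i+1,j)/(n-i-1+j)` (inequalities written cross-multiplied). -/
def IsBLHT (t n : ℕ) (lam : Fin n → ℕ) (T : ∀ i : Fin n, Fin (lam i) → ℕ) : Prop :=
  (∀ (i : Fin n) (j : Fin (lam i)), T i j < t * (n - (i : ℕ) + (j : ℕ))) ∧
  (∀ (i : Fin n) (j j' : Fin (lam i)), (j' : ℕ) = (j : ℕ) + 1 →
      T i j' * (n - (i : ℕ) + (j : ℕ)) ≤ T i j * (n - (i : ℕ) + (j : ℕ) + 1)) ∧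
  (∀ (i i' : Fin n) (j : Fin (lam i)) (j' : Fin (lam i')),
      (i' : ℕ) = (i : ℕ) + 1 → (j' : ℕ) = (j : ℕ) →
      T i' j' * (n - (i : ℕ) + (j : ℕ)) < T i j * (n - (i : ℕ) - 1 + (j : ℕ)))

open Polynomial

theorem Matrix.det_of_choose_mul_prod_factorial {n : ℕ} (v : Fin n → ℕ) :
    (∏ j : Fin n, ((j : ℕ).factorial : ℚ)) *
        (Matrix.of fun i j : Fin n => ((v i).choose j : ℚ)).det =
      (Matrix.vandermonde fun i => (v i : ℚ)).det := by
  rw [Matrix.det_eval_matrixOfPolynomials_eq_det_vandermonde _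
    (fun j : Fin n => descPochhammer ℚ j) (fun j => descPochhammer_natDegree ℚ j)
    (fun j => monic_descPochhammer ℚ j), ← Matrix.det_mul_row]
  congr 1
  ext i j
  simp [descPochhammer_eval_eq_descFactorial, Nat.descFactorial_eq_factorial_mul_choose]

theorem Matrix.det_vandermonde_eq_prod_filter {n : ℕ} (v : Fin n → ℚ) :
    (Matrix.vandermonde v).det =
      ∏ p ∈ Finset.univ.filter (fun p : Fin n × Fin n => p.1 < p.2), (v p.2 - v p.1) := by
  rw [Matrix.det_vandermonde, Finset.prod_filter, ← Finset.univ_product_univ,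
    Finset.prod_product]
  refine Finset.prod_congr rfl fun i _ => ?_
  rw [← Finset.prod_filter]
  refine Finset.prod_congr ?_ fun _ _ => rfl
  ext j
  simp

theorem prod_factorial_eq_prod_sub (n : ℕ) :
    ∏ j : Fin n, ((j : ℕ).factorial : ℚ) =
      ∏ p ∈ Finset.univ.filter (fun p : Fin n × Fin n => p.1 < p.2),
        (((p.2 : ℕ) : ℚ) - (p.1 : ℕ)) := by
  rw [← Matrix.det_vandermonde_eq_prod_filter (fun i : Fin n => ((i : ℕ) : ℚ)),
    ← Matrix.det_of_choose_mul_prod_factorial (fun i : Fin n => (i : ℕ)),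
    Matrix.det_of_isLowerTriangular]
  · simp
  · intro i j hij
    simpa using Nat.choose_eq_zero_of_lt (by simpa using hij)

theorem det_of_coeff_X_add_C_pow {n : ℕ} {t : ℚ} (ht : t ≠ 0) (lam : Fin n → ℕ) :
    (Matrix.of fun i j : Fin n =>
        ((X + C t) ^ (lam i + (n - 1 - i : ℕ)) : ℚ[X]).coeff (n - 1 - j)).det =
      t ^ (∑ i, lam i) *
        ∏ p ∈ Finset.univ.filter (fun p : Fin n × Fin n => p.1 < p.2),
          (((lam p.1 : ℚ) - ((p.1 : ℕ) + 1) - (lam p.2 : ℚ) + ((p.2 : ℕ) + 1)) /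
            (((p.2 : ℕ) + 1 : ℚ) - ((p.1 : ℕ) + 1))) := by
  set a : Fin n → ℕ := fun i => lam i + (n - 1 - i : ℕ) with ha
  have key : (Matrix.of fun i j : Fin n =>
        ((X + C t) ^ (lam i + (n - 1 - i : ℕ)) : ℚ[X]).coeff (n - 1 - j)) =
      Matrix.of fun i j : Fin n => (t ^ (n - 1 - j : ℕ))⁻¹ *
        (Matrix.of fun i j : Fin n => t ^ a i * (Matrix.of fun i j : Fin n =>
          ((a i.rev).choose j : ℚ)).submatrix Fin.revPerm Fin.revPerm i j) i j := by
    ext i j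
    have hj : ((Fin.rev j : Fin n) : ℕ) = n - 1 - j := by rw [Fin.val_rev]; omega
    simp only [Matrix.of_apply, coeff_X_add_C_pow, Matrix.submatrix_apply, Fin.revPerm_apply,
      Fin.rev_rev, hj]
    change t ^ (a i - _) * ((a i).choose _ : ℚ) = _
    by_cases h : n - 1 - (j : ℕ) ≤ a i
    · rw [pow_sub₀ _ ht h]; simp only [a]; ring
    · rw [Nat.choose_eq_zero_of_lt (by omega)]; simp
  have hV := Matrix.det_of_choose_mul_prod_factorial (fun i => a i.rev)
  rw [Matrix.det_vandermonde_eq_prod_filter, prod_factorial_eq_prod_sub] at hV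
  have hrev : ∏ p ∈ Finset.univ.filter (fun p : Fin n × Fin n => p.1 < p.2),
        ((a p.2.rev : ℚ) - a p.1.rev) =
      ∏ p ∈ Finset.univ.filter (fun p : Fin n × Fin n => p.1 < p.2),
        ((a p.1 : ℚ) - a p.2) := by
    refine Finset.prod_bij' (fun p _ => (p.2.rev, p.1.rev)) (fun p _ => (p.2.rev, p.1.rev))
      ?_ ?_ ?_ ?_ ?_ <;> simp
  rw [hrev] at hV
  have hne : ∏ p ∈ Finset.univ.filter (fun p : Fin n × Fin n => p.1 < p.2),
        (((p.2 : ℕ) : ℚ) - (p.1 : ℕ)) ≠ 0 := by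
    rw [← prod_factorial_eq_prod_sub]
    exact Finset.prod_ne_zero_iff.2 fun j _ => by exact_mod_cast Nat.factorial_ne_zero _
  rw [key, Matrix.det_mul_row, Matrix.det_mul_column, Matrix.det_submatrix_equiv_self,
    ← mul_assoc, Finset.prod_inv_distrib, ← div_eq_inv_mul, ← Finset.prod_div_distrib]
  congr 1
  · rw [← Finset.prod_pow_eq_pow_sum]
    refine Finset.prod_congr rfl fun i _ => ?_
    rw [ha, pow_add]
    field_simp
  · rw [Finset.prod_div_distrib, eq_div_iff (by simpa using hne), mul_comm]
    have h1 : ∀ i : Fin n, (a i : ℚ) = lam i + ((n : ℚ) - 1 - (i : ℕ)) := by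
      intro i
      rw [ha]
      push_cast [Nat.cast_sub (show (i : ℕ) ≤ n - 1 by omega),
        Nat.cast_sub (show 1 ≤ n by have := i.2; omega)]
      ring
    convert hV using 2
    · ring_nf
    · rw [h1, h1]; ring

/-- The one-particle evolution attached to a list of sites: the particle starts at `a` and, for
each site `m` of the list in turn, may jump from `m` to `m - 1`; `evolve f l a` is the sum of `f`
over the end points of all its trajectories. -/
noncomputable def evolve (f : ℕ → ℚ[X]) : List ℕ → ℕ → ℚ[X]
  | [], a => f a
  | m :: l, a => evolve f l a + if a = m then evolve f l (a - 1) else 0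

theorem evolve_append (f : ℕ → ℚ[X]) (l l' : List ℕ) :
    evolve f (l ++ l') = evolve (evolve f l') l := by
  induction l with
  | nil => rfl
  | cons m l ih => funext a; simp [evolve, ih]

/-- The sites `r + k, …, r + 1` in decreasing order. -/
def sweep (r k : ℕ) : List ℕ := (List.range' (r + 1) k).reverse

theorem sweep_succ (r k : ℕ) : sweep r (k + 1) = (r + 1 + k) :: sweep r k := by
  simp [sweep, List.range'_concat]

theorem evolve_sweep (y : ℚ[X]) (f : ℕ → ℚ[X]) (r N : ℕ)
    (hlo : ∀ a ≤ r, f a = y ^ a)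
    (hhi : ∀ a, r < a → a ≤ N → f a = y ^ (r + 1) * (y + 1) ^ (a - (r + 1))) (k : ℕ)
    (hk : r + k ≤ N) :
    (∀ a ≤ r, evolve f (sweep r k) a = y ^ a) ∧
    (∀ a, r ≤ a → a ≤ r + k → evolve f (sweep r k) a = y ^ r * (y + 1) ^ (a - r)) ∧
    (∀ a, r + k < a → evolve f (sweep r k) a = f a) := by
  induction k with
  | zero =>
    refine ⟨hlo, fun a h1 h2 => ?_, fun a _ => rfl⟩
    obtain rfl : a = r := by omega
    simp [sweep, evolve, hlo]
  | succ k ih =>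
    obtain ⟨h1, h2, h3⟩ := ih (by omega)
    simp only [sweep_succ, evolve]
    refine ⟨fun a ha => ?_, fun a ha ha' => ?_, fun a ha => ?_⟩
    · rw [if_neg (by omega), h1 a ha, add_zero]
    · split_ifs with h
      · subst h
        rw [h3 _ (by omega), hhi _ (by omega) (by omega), h2 _ (by omega) (by omega),
          show r + 1 + k - (r + 1) = k by omega, show r + 1 + k - 1 - r = k by omega,
          show r + 1 + k - r = k + 1 by omega]
        ring
      · rw [h2 a ha (by omega), add_zero]
    · rw [if_neg (by omega), h3 a (by omega), add_zero]

/-- The sites visited at one level: sweeps over `N, …, r + 1` for `r = 0, …, N - 1`. -/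
def levelSites (N : ℕ) : List ℕ := (List.range N).flatMap fun r => sweep r (N - r)

theorem evolve_levelSites (y : ℚ[X]) (f : ℕ → ℚ[X]) (N : ℕ) (hf : ∀ a ≤ N, f a = y ^ a) :
    ∀ a ≤ N, evolve f (levelSites N) a = (y + 1) ^ a := by
  have key : ∀ k s, s + k = N →
      (∀ a ≤ s, evolve f ((List.range' s k).flatMap fun r => sweep r (N - r)) a = y ^ a) ∧
      (∀ a, s ≤ a → a ≤ N →
        evolve f ((List.range' s k).flatMap fun r => sweep r (N - r)) a =
          y ^ s * (y + 1) ^ (a - s)) := by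
    intro k
    induction k with
    | zero =>
      intro s hs
      refine ⟨fun a ha => hf a (by omega), fun a ha ha' => ?_⟩
      obtain rfl : a = s := by omega
      simpa [evolve] using hf a ha'
    | succ k ih =>
      intro s hs
      obtain ⟨h1, h2⟩ := ih (s + 1) (by omega)
      rw [List.range'_succ, List.flatMap_cons, evolve_append]
      obtain ⟨g1, g2, -⟩ := evolve_sweep y _ s N (fun a ha => h1 a (by omega))
        (fun a ha ha' => h2 a ha ha') (N - s) (by omega)
      exact ⟨g1, fun a ha ha' => g2 a ha (by omega)⟩
  intro a ha
  rw [levelSites, List.range_eq_range']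
  simpa using (key N 0 (by omega)).2 a (by omega) ha

theorem evolve_flatMap_levelSites (f : ℕ → ℚ[X]) (N t : ℕ) (y : ℚ[X])
    (hf : ∀ a ≤ N, f a = y ^ a) :
    ∀ a ≤ N, evolve f ((List.range t).flatMap fun _ => levelSites N) a = (y + C (t : ℚ)) ^ a := by
  induction t generalizing f y with
  | zero => simpa [evolve] using hf
  | succ t ih =>
    rw [List.range_succ, List.flatMap_append, evolve_append]
    intro a ha
    rw [ih _ (y + 1) (by simpa using evolve_levelSites y f N hf) a ha]
    push_cast [C_add]
    rw [C_1]
    ring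

/-- The total order in which the pairs (content, entry) of a lecture hall tableau are compared:
by the quotient of the entry by the content, then by the remainder, then by decreasing content. -/
def SlotLT (x y : ℕ × ℕ) : Prop :=
  x.2 / x.1 < y.2 / y.1 ∨ x.2 / x.1 = y.2 / y.1 ∧
    (x.2 % x.1 < y.2 % y.1 ∨ x.2 % x.1 = y.2 % y.1 ∧ y.1 < x.1)

theorem SlotLT.asymm {x y : ℕ × ℕ} (h : SlotLT x y) : ¬ SlotLT y x := by
  unfold SlotLT at *
  omega

theorem mul_succ_le_mul_iff {c x y : ℕ} (hc : 0 < c) :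
    x * c ≤ y * (c + 1) ↔ SlotLT (c + 1, x) (c, y) := by
  have hx := Nat.div_add_mod x (c + 1)
  have hy := Nat.div_add_mod y c
  have hrx := Nat.mod_lt x (Nat.succ_pos c)
  have hry := Nat.mod_lt y hc
  unfold SlotLT
  simp only
  generalize x / (c + 1) = q at *
  generalize x % (c + 1) = r at *
  generalize y / c = q' at *
  generalize y % c = r' at *
  subst hx hy
  rcases lt_trichotomy q q' with h | h | h
  · refine iff_of_true ?_ (Or.inl h)
    have : (q + 1) * (c * (c + 1)) ≤ q' * (c * (c + 1)) := Nat.mul_le_mul_right _ h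
    nlinarith [Nat.zero_le (r' * (c + 1)), Nat.mul_le_mul_right c (Nat.lt_succ_iff.1 hrx)]
  · subst h
    have h1 : ((c + 1) * q + r) * c ≤ (c * q + r') * (c + 1) ↔ r * c ≤ r' * c + r' := by
      constructor <;> intro h <;> nlinarith
    rw [h1]
    simp only [lt_irrefl, true_and, false_or]
    constructor
    · intro h
      by_contra! hcon
      have : r' + 1 ≤ r := by omega
      nlinarith [Nat.mul_le_mul_right c this]
    · rintro (h | h)
      · nlinarith [Nat.mul_le_mul_right c h.le]
      · rw [h.1]; omega
  · refine iff_of_false ?_ (by omega)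
    have : (q' + 1) * (c * (c + 1)) ≤ q * (c * (c + 1)) := Nat.mul_le_mul_right _ h
    have := Nat.mul_le_mul_right (c + 1) (Nat.succ_le_of_lt hry)
    nlinarith [Nat.zero_le (r * c)]

theorem mul_succ_lt_mul_iff {c x y : ℕ} (hc : 0 < c) :
    y * (c + 1) < x * c ↔ SlotLT (c, y) (c + 1, x) := by
  rw [← not_le, mul_succ_le_mul_iff hc]
  unfold SlotLT
  simp only
  omega

/-- All slots with content at most `N` and ratio below `t`, in increasing order. -/
def slots (t N : ℕ) : List (ℕ × ℕ) :=
  (List.range t).flatMap fun q => (List.range N).flatMap fun r =>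
    (sweep r (N - r)).map fun m => (m, m * q + r)

theorem map_fst_slots (t N : ℕ) :
    (slots t N).map Prod.fst = (List.range t).flatMap fun _ => levelSites N := by
  simp [slots, levelSites, List.map_flatMap, Function.comp_def]

theorem mem_sweep {r k m : ℕ} : m ∈ sweep r k ↔ r < m ∧ m ≤ r + k := by
  simp [sweep, List.mem_range'_1]
  omega

theorem pairwise_sweep (r k : ℕ) : (sweep r k).Pairwise (· > ·) := by
  simpa [sweep, List.pairwise_reverse] using List.pairwise_lt_range' (s := r + 1) (n := k)

theorem mem_slots {t N m k : ℕ} : (m, k) ∈ slots t N ↔ 0 < m ∧ m ≤ N ∧ k < t * m := by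
  simp only [slots, List.mem_flatMap, List.mem_range, List.mem_map, mem_sweep, Prod.mk.injEq]
  constructor
  · rintro ⟨q, hq, r, hr, m, hm, rfl, rfl⟩
    refine ⟨by omega, by omega, ?_⟩
    have := Nat.mul_le_mul_right m (Nat.succ_le_of_lt hq)
    nlinarith
  · rintro ⟨h0, hN, hk⟩
    have := Nat.mod_lt k h0
    exact ⟨k / m, (Nat.div_lt_iff_lt_mul h0).2 hk, k % m, by omega, m, by omega, rfl,
      Nat.div_add_mod k m⟩

theorem pairwise_slots (t N : ℕ) : (slots t N).Pairwise SlotLT := by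
  have hd : ∀ {m q r : ℕ}, r < m → (m * q + r) / m = q := fun h => by
    rw [Nat.mul_add_div (by omega), Nat.div_eq_of_lt h, add_zero]
  have hm : ∀ {m q r : ℕ}, r < m → (m * q + r) % m = r := fun h => by
    rw [Nat.mul_add_mod, Nat.mod_eq_of_lt h]
  refine List.pairwise_flatMap.2 ⟨fun q _ => List.pairwise_flatMap.2 ⟨fun r _ => ?_, ?_⟩, ?_⟩
  · rw [List.pairwise_map]
    refine (pairwise_sweep r _).imp_of_mem fun {m m'} h h' hlt => ?_
    rw [mem_sweep] at h h'
    simpa [SlotLT, hd h.1, hd h'.1, hm h.1, hm h'.1] using hlt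
  · refine List.pairwise_lt_range.imp fun {r r'} hlt => ?_
    simp only [List.mem_map, mem_sweep]
    rintro _ ⟨m, h, rfl⟩ _ ⟨m', h', rfl⟩
    simpa [SlotLT, hd h.1, hd h'.1, hm h.1, hm h'.1] using Or.inl hlt
  · refine List.pairwise_lt_range.imp fun {q q'} hlt => ?_
    simp only [List.mem_flatMap, List.mem_map, mem_sweep]
    rintro _ ⟨r, -, m, h, rfl⟩ _ ⟨r', -, m', h', rfl⟩
    simp only [SlotLT, hd h.1, hd h'.1]
    omega

/-- Fillings of the Young diagram of `μ` (extended by zero outside of it) whose pairs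
(content, entry) lie in `l` and strictly decrease along rows and columns with respect to `R`. -/
def fillings {n : ℕ} (R : ℕ × ℕ → ℕ × ℕ → Prop) (l : List (ℕ × ℕ)) (μ : Fin n → ℕ) :
    Set (Fin n → ℕ → ℕ) :=
  {T | (∀ i j, μ i ≤ j → T i j = 0) ∧
    (∀ i j, j < μ i → (n - i + j, T i j) ∈ l) ∧
    (∀ i j, j + 1 < μ i → R (n - i + (j + 1), T i (j + 1)) (n - i + j, T i j)) ∧
    ∀ (i i' : Fin n) (j : ℕ), (i' : ℕ) = i + 1 → j < μ i → j < μ i' →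
      R (n - i' + j, T i' j) (n - i + j, T i j)}

/-- The matrix of one-particle transition coefficients for the particles of the partition `μ`. -/
noncomputable def transitionMatrix {n : ℕ} (l : List ℕ) (μ : Fin n → ℕ) :
    Matrix (Fin n) (Fin n) ℚ :=
  Matrix.of fun i j => (evolve (fun a => X ^ a) l (μ i + (n - 1 - i))).coeff (n - 1 - j)

section Fillings

variable {n : ℕ} {R : ℕ × ℕ → ℕ × ℕ → Prop}

theorem det_transitionMatrix_nil_zero : (transitionMatrix [] (0 : Fin n → ℕ)).det = 1 := by
  have : transitionMatrix [] (0 : Fin n → ℕ) = 1 := by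
    ext i j
    simp only [transitionMatrix, evolve, Matrix.of_apply, coeff_X_pow, Matrix.one_apply,
      Pi.zero_apply, Fin.ext_iff]
    exact if_congr (by omega) rfl rfl
  rw [this, Matrix.det_one]

theorem det_transitionMatrix_nil {μ : Fin n → ℕ} (hμ : Antitone μ) (h0 : μ ≠ 0) :
    (transitionMatrix [] μ).det = 0 := by
  obtain ⟨i, hi⟩ := Function.ne_iff.1 h0
  have hn : 0 < n := i.pos
  have hle : μ i ≤ μ ⟨0, hn⟩ := hμ (Fin.mk_le_of_le_val (Nat.zero_le _))
  rw [Pi.zero_apply] at hi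
  refine Matrix.det_eq_zero_of_row_eq_zero ⟨0, hn⟩ fun j => ?_
  simp only [transitionMatrix, evolve, Matrix.of_apply, coeff_X_pow]
  exact if_neg (by omega)

theorem fillings_nil_zero : fillings R [] (0 : Fin n → ℕ) = {0} := by
  ext T
  simp only [fillings, Set.mem_ofPred_eq, Pi.zero_apply, Set.mem_singleton_iff]
  constructor
  · rintro ⟨h, -⟩
    funext i j
    exact h i j (Nat.zero_le _)
  · rintro rfl
    simp

theorem fillings_nil {μ : Fin n → ℕ} (h0 : μ ≠ 0) : fillings R [] μ = ∅ := by
  obtain ⟨i, hi⟩ := Function.ne_iff.1 h0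
  refine Set.eq_empty_of_forall_notMem fun T hT => ?_
  simpa using hT.2.1 i 0 (Nat.pos_of_ne_zero hi)

theorem fillings_mono {l l' : List (ℕ × ℕ)} (h : l ⊆ l') (μ : Fin n → ℕ) :
    fillings R l μ ⊆ fillings R l' μ :=
  fun _ hT => ⟨hT.1, fun i j hj => h (hT.2.1 i j hj), hT.2.2⟩

theorem strictAnti_add_sub {μ : Fin n → ℕ} (hμ : Antitone μ) :
    StrictAnti fun i : Fin n => μ i + (n - 1 - i) := by
  intro i j hij
  have := hμ hij.le
  have : (i : ℕ) < j := hij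
  simp only
  omega

/-- A cell carrying the smallest slot is a corner of the diagram. -/
theorem corner_of_min_slot (hR : ∀ x y, R x y → ¬ R y x) {s : ℕ × ℕ} {l : List (ℕ × ℕ)}
    (hs : ∀ x ∈ l, R s x) {μ : Fin n → ℕ} {T : Fin n → ℕ → ℕ} (hT : T ∈ fillings R (s :: l) μ)
    {i : Fin n} {j : ℕ} (hj : j < μ i) (hij : (n - i + j, T i j) = s) :
    j + 1 = μ i ∧ ∀ i' : Fin n, (i' : ℕ) = i + 1 → μ i' < μ i := by
  obtain ⟨-, hmem, hrow, hcol⟩ := hT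
  have hmin : ∀ x ∈ s :: l, ¬ R x s := by
    intro x hx hxs
    rcases List.mem_cons.1 hx with rfl | hx
    · exact hR _ _ hxs hxs
    · exact hR _ _ hxs (hs x hx)
  have hj1 : j + 1 = μ i := by
    by_contra hne
    exact hmin _ (hmem i (j + 1) (by omega)) (hij ▸ hrow i j (by omega))
  refine ⟨hj1, fun i' hi' => ?_⟩
  by_contra hle
  exact hmin _ (hmem i' j (by omega)) (hij ▸ hcol i i' j hi' hj (by omega))

theorem fillings_cons_of_not_corner (hR : ∀ x y, R x y → ¬ R y x) {s : ℕ × ℕ}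
    {l : List (ℕ × ℕ)} (hs : ∀ x ∈ l, R s x) {μ : Fin n → ℕ}
    (hc : ∀ i : Fin n, 0 < μ i → (∀ i' : Fin n, (i' : ℕ) = i + 1 → μ i' < μ i) →
      μ i + (n - 1 - i) ≠ s.1) :
    fillings R (s :: l) μ = fillings R l μ := by
  refine Set.Subset.antisymm (fun T hT => ⟨hT.1, fun i j hj => ?_, hT.2.2⟩)
    (fillings_mono (List.subset_cons_self _ _) _)
  refine (List.mem_cons.1 (hT.2.1 i j hj)).resolve_left fun h => ?_
  obtain ⟨h1, h2⟩ := corner_of_min_slot hR hs hT hj h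
  refine hc i (by omega) h2 ?_
  rw [← h]
  simp only
  omega

/-- Writing the entry `k` into the cell `(i, c)`. -/
def setEntry (i : Fin n) (c k : ℕ) (T : Fin n → ℕ → ℕ) : Fin n → ℕ → ℕ :=
  Function.update T i (Function.update (T i) c k)

theorem setEntry_apply (i : Fin n) (c k : ℕ) (T : Fin n → ℕ → ℕ) (i' : Fin n) (j : ℕ) :
    setEntry i c k T i' j = if i' = i ∧ j = c then k else T i' j := by
  unfold setEntry
  by_cases h : i' = i
  · subst h
    by_cases h' : j = c <;> simp [h']
  · simp [h]

theorem fillings_cons_of_corner (hR : ∀ x y, R x y → ¬ R y x) {m k : ℕ}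
    {l : List (ℕ × ℕ)} (hs : ∀ x ∈ l, R (m, k) x) {μ : Fin n → ℕ} (hμ : Antitone μ) {i : Fin n}
    {c : ℕ} (hi : μ i = c + 1) (hcor : ∀ i' : Fin n, (i' : ℕ) = i + 1 → μ i' < μ i)
    (him : μ i + (n - 1 - i) = m) :
    fillings R ((m, k) :: l) μ =
      fillings R l μ ∪ setEntry i c k '' fillings R l (Function.update μ i c) := by
  have hval : ∀ i' : Fin n, Function.update μ i c i' = if i' = i then c else μ i' :=
    fun i' => Function.update_apply _ _ _ _
  have hcm : n - (i : ℕ) + c = m := by omega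
  ext T
  constructor
  · intro hT
    have hother : ∀ i' j, j < μ i' → ¬ (i' = i ∧ j = c) → (n - (i' : ℕ) + j, T i' j) ∈ l := by
      intro i' j hj hne
      refine (List.mem_cons.1 (hT.2.1 i' j hj)).resolve_left fun h => hne ?_
      obtain ⟨h1, -⟩ := corner_of_min_slot hR hs hT hj h
      have : i' = i := (strictAnti_add_sub hμ).injective (by
        have := congrArg Prod.fst h
        simp only at this ⊢
        omega)
      subst this
      exact ⟨rfl, by omega⟩
    by_cases hTi : (m, T i c) ∈ l
    · left
      refine ⟨hT.1, fun i' j hj => ?_, hT.2.2⟩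
      by_cases h : i' = i ∧ j = c
      · obtain ⟨rfl, rfl⟩ := h
        rwa [hcm]
      · exact hother i' j hj h
    · right
      have hk : T i c = k := by
        have := hT.2.1 i c (by omega)
        rw [hcm] at this
        simpa using (List.mem_cons.1 this).resolve_right hTi
      refine ⟨setEntry i c 0 T, ⟨fun i' j hj => ?_, fun i' j hj => ?_, fun i' j hj => ?_,
        fun i₁ i₂ j h12 hj₁ hj₂ => ?_⟩, ?_⟩
      · rw [setEntry_apply]
        split_ifs with h
        · rfl
        · refine hT.1 i' j ?_
          rw [hval] at hj
          split_ifs at hj with h'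
          · subst h'
            simp only [true_and] at h
            omega
          · exact hj
      · rw [hval] at hj
        rw [setEntry_apply, if_neg]
        · refine hother i' j ?_ ?_ <;> split_ifs at hj with h <;> grind
        · grind
      · rw [hval] at hj
        rw [setEntry_apply, setEntry_apply, if_neg (by grind), if_neg (by grind)]
        exact hT.2.2.1 i' j (by grind)
      · rw [hval] at hj₁ hj₂
        rw [setEntry_apply, setEntry_apply, if_neg (by grind), if_neg (by grind)]
        exact hT.2.2.2 i₁ i₂ j h12 (by grind) (by grind)
      · funext i' j
        rw [setEntry_apply, setEntry_apply]
        split_ifs with h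
        · rw [h.1, h.2, hk]
        · rfl
  · rintro (hT | ⟨T, hT, rfl⟩)
    · exact fillings_mono (List.subset_cons_self _ _) _ hT
    · have hold : ∀ i' j, j < μ i' → ¬ (i' = i ∧ j = c) → j < Function.update μ i c i' := by
        intro i' j hj h
        rw [hval]
        grind
      refine ⟨fun i' j hj => ?_, fun i' j hj => ?_, fun i' j hj => ?_,
        fun i₁ i₂ j h12 hj₁ hj₂ => ?_⟩
      · rw [setEntry_apply, if_neg (by grind)]
        refine hT.1 i' j ?_
        rw [hval]
        grind
      · rw [setEntry_apply]
        split_ifs with h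
        · rw [h.1, h.2, hcm]
          exact List.mem_cons_self
        · exact List.mem_cons_of_mem _ (hT.2.1 i' j (hold i' j hj h))
      · rw [setEntry_apply, setEntry_apply, if_neg (c := i' = i ∧ j = c) (by grind)]
        split_ifs with h
        · rw [h.1, h.2, hcm]
          exact hs _ (h.1 ▸ hT.2.1 i' j (hold i' j (by omega) (by omega)))
        · exact hT.2.2.1 i' j (hold i' _ hj h)
      · have h1 : ¬ (i₁ = i ∧ j = c) := by
          rintro ⟨rfl, rfl⟩
          have := hcor i₂ h12
          omega
        rw [setEntry_apply, setEntry_apply, if_neg h1]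
        split_ifs with h
        · rw [h.1, h.2, hcm]
          exact hs _ (h.2 ▸ hT.2.1 i₁ j (hold i₁ j hj₁ h1))
        · exact hT.2.2.2 i₁ i₂ j h12 (hold _ _ hj₁ h1) (hold _ _ hj₂ h)

theorem ncard_fillings_cons_of_corner (hR : ∀ x y, R x y → ¬ R y x) {m k : ℕ}
    {l : List (ℕ × ℕ)} (hs : ∀ x ∈ l, R (m, k) x) {μ : Fin n → ℕ} (hμ : Antitone μ) {i : Fin n}
    {c : ℕ} (hi : μ i = c + 1) (hcor : ∀ i' : Fin n, (i' : ℕ) = i + 1 → μ i' < μ i)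
    (him : μ i + (n - 1 - i) = m) (hfin : (fillings R l μ).Finite)
    (hfin' : (fillings R l (Function.update μ i c)).Finite) :
    (fillings R ((m, k) :: l) μ).ncard =
      (fillings R l μ).ncard + (fillings R l (Function.update μ i c)).ncard := by
  rw [fillings_cons_of_corner hR hs hμ hi hcor him, Set.ncard_union_eq ?_ hfin (hfin'.image _),
    Set.InjOn.ncard_image]
  · intro T hT T' hT' h
    funext i' j
    have := congrFun (congrFun h i') j
    rw [setEntry_apply, setEntry_apply] at this
    split_ifs at this with h'
    · rw [h'.1, h'.2, hT.1 i c (by simp), hT'.1 i c (by simp)]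
    · exact this
  · rw [Set.disjoint_left]
    rintro _ hT ⟨T, -, rfl⟩
    have := hT.2.1 i c (by omega)
    rw [setEntry_apply, if_pos ⟨rfl, rfl⟩, show n - (i : ℕ) + c = m by omega] at this
    exact hR _ _ (hs _ this) (hs _ this)

theorem transitionMatrix_cons_of_ne {m : ℕ} {l : List ℕ} {μ : Fin n → ℕ}
    (h : ∀ i : Fin n, μ i + (n - 1 - i) ≠ m) :
    transitionMatrix (m :: l) μ = transitionMatrix l μ := by
  ext i j
  simp [transitionMatrix, evolve, h]

theorem det_transitionMatrix_cons {m : ℕ} {l : List ℕ} {μ : Fin n → ℕ} (hμ : Antitone μ)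
    {i : Fin n} (h : μ i + (n - 1 - i) = m) :
    (transitionMatrix (m :: l) μ).det = (transitionMatrix l μ).det +
      ((transitionMatrix l μ).updateRow i
        fun j => (evolve (fun a => X ^ a) l (m - 1)).coeff (n - 1 - j)).det := by
  have : transitionMatrix (m :: l) μ = (transitionMatrix l μ).updateRow i
      (transitionMatrix l μ i +
        fun j : Fin n => (evolve (fun a => X ^ a) l (m - 1)).coeff (n - 1 - j)) := by
    ext i' j
    rw [Matrix.updateRow_apply]
    split_ifs with h'
    · subst h'
      simp [transitionMatrix, evolve, h]
    · have hne : μ i' + (n - 1 - i') ≠ m := fun h'' =>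
        h' ((strictAnti_add_sub hμ).injective (h''.trans h.symm))
      simp [transitionMatrix, evolve, hne]
  rw [this, Matrix.det_updateRow_add, Matrix.updateRow_eq_self]

theorem antitone_update {μ : Fin n → ℕ} (hμ : Antitone μ) {i : Fin n} {c : ℕ} (hi : μ i = c + 1)
    (hcor : ∀ i' : Fin n, (i' : ℕ) = i + 1 → μ i' < μ i) : Antitone (Function.update μ i c) := by
  intro a b hab
  have h1 := hμ hab
  simp only [Function.update_apply]
  split_ifs with hb ha ha
  · rfl
  · subst hb; omega
  · subst ha
    have hlt : (a : ℕ) < b := lt_of_le_of_ne hab fun h => hb (Fin.ext h.symm)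
    have h2 := hcor ⟨a + 1, by omega⟩ rfl
    have h3 : μ b ≤ μ ⟨a + 1, by omega⟩ := hμ (Fin.mk_le_of_le_val hlt)
    omega
  · exact h1

theorem ncard_fillings (hR : ∀ x y, R x y → ¬ R y x) (l : List (ℕ × ℕ)) (hl : l.Pairwise R)
    (hpos : ∀ x ∈ l, 0 < x.1) (μ : Fin n → ℕ) (hμ : Antitone μ) :
    (fillings R l μ).Finite ∧
      ((fillings R l μ).ncard : ℚ) = (transitionMatrix (l.map Prod.fst) μ).det := by
  induction l generalizing μ with
  | nil =>
    by_cases h0 : μ = 0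
    · subst h0
      rw [fillings_nil_zero]
      simp [det_transitionMatrix_nil_zero]
    · simp [fillings_nil h0, det_transitionMatrix_nil hμ h0]
  | cons s l ih =>
    obtain ⟨m, k⟩ := s
    obtain ⟨hs, hl⟩ := List.pairwise_cons.1 hl
    have hm : 0 < m := hpos _ List.mem_cons_self
    have ih := ih hl fun x hx => hpos x (List.mem_cons_of_mem _ hx)
    obtain ⟨hfin, hcard⟩ := ih μ hμ
    rw [List.map_cons]
    by_cases hex : ∃ i : Fin n, μ i + (n - 1 - i) = m
    · obtain ⟨i, him⟩ := hex
      rw [det_transitionMatrix_cons hμ him]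
      by_cases hcor : 0 < μ i ∧ ∀ i' : Fin n, (i' : ℕ) = i + 1 → μ i' < μ i
      · obtain ⟨hi, hcor⟩ := hcor
        obtain ⟨c, hc⟩ := Nat.exists_eq_add_one.2 hi
        obtain ⟨hfin', hcard'⟩ := ih _ (antitone_update hμ hc hcor)
        constructor
        · rw [fillings_cons_of_corner hR hs hμ hc hcor him]
          exact hfin.union (hfin'.image _)
        rw [ncard_fillings_cons_of_corner hR hs hμ hc hcor him hfin hfin', Nat.cast_add, hcard,
          hcard']
        congr 2
        ext i' j
        rw [Matrix.updateRow_apply]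
        simp only [transitionMatrix, Matrix.of_apply, Function.update_apply]
        split_ifs with h
        · rw [h, show c + (n - 1 - (i : ℕ)) = m - 1 by omega]
        · rfl
      · rw [fillings_cons_of_not_corner hR hs]
        · refine ⟨hfin, ?_⟩
          rw [hcard, left_eq_add]
          obtain ⟨i', hi', hμi'⟩ : ∃ i' : Fin n, (i' : ℕ) = i + 1 ∧ μ i' = μ i := by
            by_cases h0 : μ i = 0
            · refine ⟨⟨i + 1, by omega⟩, rfl, ?_⟩
              have : μ ⟨i + 1, by omega⟩ ≤ μ i := hμ (Fin.le_def.2 (Nat.le_succ _))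
              omega
            · push Not at hcor
              obtain ⟨i', h1, h2⟩ := hcor (by omega)
              exact ⟨i', h1, (hμ (Fin.le_def.2 (by omega))).antisymm h2⟩
          have hne : i ≠ i' := fun h => by rw [← h] at hi'; omega
          refine Matrix.det_zero_of_row_eq hne ?_
          funext j
          rw [Matrix.updateRow_self, Matrix.updateRow_ne hne.symm]
          simp only [transitionMatrix, Matrix.of_apply]
          rw [show μ i' + (n - 1 - (i' : ℕ)) = m - 1 by omega]
        · intro i' hi' hcor' him'
          have : i' = i := (strictAnti_add_sub hμ).injective (him'.trans him.symm)
          subst this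
          exact hcor ⟨hi', hcor'⟩
    · push Not at hex
      rw [fillings_cons_of_not_corner hR hs fun i _ _ => hex i,
        transitionMatrix_cons_of_ne hex]
      exact ⟨hfin, hcard⟩

/-- Extension by zero of a filling of the diagram of `lam`. -/
def extendZero {lam : Fin n → ℕ} (T : ∀ i : Fin n, Fin (lam i) → ℕ) (i : Fin n) (j : ℕ) : ℕ :=
  if h : j < lam i then T i ⟨j, h⟩ else 0

theorem extendZero_apply {lam : Fin n → ℕ} {T : ∀ i : Fin n, Fin (lam i) → ℕ} {i : Fin n} {j : ℕ}
    (h : j < lam i) : extendZero T i j = T i ⟨j, h⟩ :=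
  dif_pos h

theorem isBLHT_iff_extendZero_mem_fillings {t : ℕ} {lam : Fin n → ℕ} {N : ℕ}
    (hN : ∀ i : Fin n, lam i + n ≤ N) (T : ∀ i : Fin n, Fin (lam i) → ℕ) :
    IsBLHT t n lam T ↔
      extendZero T ∈ fillings SlotLT (slots t N) lam := by
  constructor
  · rintro ⟨hb, hrow, hcol⟩
    refine ⟨fun i j hj => dif_neg (Nat.not_lt.2 hj), fun i j hj => ?_, fun i j hj => ?_,
      fun i i' j hi' hj hj' => ?_⟩
    · have := hN i
      rw [mem_slots, extendZero_apply hj]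
      exact ⟨by omega, by omega, hb i ⟨j, hj⟩⟩
    · rw [extendZero_apply hj, extendZero_apply (Nat.lt_of_succ_lt hj), ← add_assoc, ← mul_succ_le_mul_iff (by omega)]
      exact hrow i ⟨j, by omega⟩ ⟨j + 1, hj⟩ rfl
    · rw [extendZero_apply hj, extendZero_apply hj']
      have h := hcol i i' ⟨j, hj⟩ ⟨j, hj'⟩ hi' rfl
      simp only at h
      rw [show n - (i : ℕ) + j = n - i' + j + 1 by omega,
        show n - (i : ℕ) - 1 + j = n - i' + j by omega] at h
      rw [show n - (i : ℕ) + j = n - i' + j + 1 by omega]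
      exact (mul_succ_lt_mul_iff (by omega)).1 h
  · rintro ⟨-, hb, hrow, hcol⟩
    refine ⟨fun i j => ?_, fun i j j' hj' => ?_, fun i i' j j' hi' hj' => ?_⟩
    · have := hb i j j.2
      rw [mem_slots, extendZero_apply j.2] at this
      exact this.2.2
    · obtain ⟨j', hlt⟩ := j'
      simp only at hj'
      subst hj'
      have := hrow i j hlt
      rwa [extendZero_apply hlt, extendZero_apply j.2, ← add_assoc, ← mul_succ_le_mul_iff (by omega)] at this
    · obtain ⟨j', hlt⟩ := j'
      simp only at hj'
      subst hj'
      have := hcol i i' j hi' j.2 hlt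
      rw [extendZero_apply hlt, extendZero_apply j.2, show n - (i : ℕ) + j = n - i' + j + 1 by omega,
        ← mul_succ_lt_mul_iff (by omega)] at this
      rwa [show n - (i : ℕ) + j = n - i' + j + 1 by omega,
        show n - (i : ℕ) - 1 + j = n - i' + j by omega]

theorem card_isBLHT_eq_ncard_fillings {t : ℕ} {lam : Fin n → ℕ} {N : ℕ}
    (hN : ∀ i : Fin n, lam i + n ≤ N) :
    Nat.card {T : ∀ i : Fin n, Fin (lam i) → ℕ // IsBLHT t n lam T} =
      (fillings SlotLT (slots t N) lam).ncard := by
  rw [← Nat.card_coe_set_eq]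
  refine Nat.card_congr
    { toFun := fun T => ⟨_, (isBLHT_iff_extendZero_mem_fillings hN T.1).1 T.2⟩
      invFun := fun T => ⟨fun i j => T.1 i j,
        (isBLHT_iff_extendZero_mem_fillings hN _).2 ?_⟩
      left_inv := fun T => ?_
      right_inv := fun T => ?_ }
  · convert T.2 using 1
    funext i j
    simp only [extendZero, dite_eq_ite, ite_eq_left_iff, not_lt]
    exact fun h => (T.2.1 i j h).symm
  · ext i j
    exact extendZero_apply j.2
  · ext i j
    simp only [extendZero, dite_eq_ite, ite_eq_left_iff, not_lt]
    exact fun h => (T.2.1 i j h).symm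

end Fillings

/-- The number of bounded lecture hall tableaux of shape `λ` bounded by `t` is
`t^{|λ|} ∏_{1 ≤ i < j ≤ n} (λ_i - i - λ_j + j)/(j - i)`. -/
theorem blht_count (t n : ℕ) (ht : 0 < t) (hn : 0 < n) (lam : Fin n → ℕ)
    (hpart : ∀ i j : Fin n, i ≤ j → lam j ≤ lam i) :
    (Nat.card {T : ∀ i : Fin n, Fin (lam i) → ℕ // IsBLHT t n lam T} : ℚ) =
      (t : ℚ) ^ (∑ i, lam i) *
        ∏ p ∈ Finset.univ.filter (fun p : Fin n × Fin n => p.1 < p.2),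
          (((lam p.1 : ℚ) - ((p.1 : ℕ) + 1) - (lam p.2 : ℚ) + ((p.2 : ℕ) + 1)) /
            (((p.2 : ℕ) + 1 : ℚ) - ((p.1 : ℕ) + 1))) := by

  have hlam : Antitone lam := fun i j h => hpart i j h
  have hN : ∀ i : Fin n, lam i + n ≤ ∑ i, lam i + n := fun i =>
    Nat.add_le_add_right (Finset.single_le_sum (fun _ _ => Nat.zero_le _) (Finset.mem_univ i)) n
  rw [card_isBLHT_eq_ncard_fillings hN,
    (ncard_fillings (fun _ _ => SlotLT.asymm) _ (pairwise_slots t _)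
      (fun x hx => (mem_slots.1 hx).1) lam hlam).2, map_fst_slots,
    ← det_of_coeff_X_add_C_pow (Nat.cast_ne_zero.2 ht.ne')]
  congr 1
  ext i j
  have := hN i
  rw [transitionMatrix, Matrix.of_apply, Matrix.of_apply,
    evolve_flatMap_levelSites _ _ t X (fun _ _ => rfl) _ (by omega)]
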